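/- arXiv:2508.03308 — 4 statements merged into one kernel-verified Lean document; each statement's English description precedes it below -/
import Mathlib

section
/- Let d be a prime and k ≥ 1. Let c_0 ∈ ℂ be a root of the Gleason polynomial G_{d,n} for some n ≥ 1, and set K = ℚ(c_0). Then there exists a polynomial F(x) ∈ O_K[x] such that f_{d,c_0}^k(x) = x^{d^k} + d·x^d·F(x) + a_i(c_0), where i is the smallest positive integer with k ≡ i (mod n). In particular, if n divides k, then f_{d,c_0}^k(x) = x^{d^k} + d·x^d·F(x) for some F(x) ∈ O_K[x]. -/
open Polynomial IntermediateField

noncomputable section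

/-- The value sequence `a_i(c)`: `a_0 = 0`, `a_{i+1} = a_i ^ d + c`. -/
def aSeq (d : ℕ) {F : Type*} [CommRing F] (c : F) : ℕ → F
  | 0 => 0
  | i + 1 => aSeq d c i ^ d + c

/-- The polynomials `a_i ∈ ℤ[c]`: `a_0 = 0`, `a_{i+1} = a_i ^ d + c`. -/
def aPoly (d : ℕ) : ℕ → Polynomial ℤ
  | 0 => 0
  | i + 1 => aPoly d i ^ d + X

/-- Iterates of `f_{d,c} = x^d + c`: `f^0 = x`, `f^{k+1} = f ∘ f^k`. -/
def fIter (d : ℕ) {F : Type*} [CommRing F] (c : F) : ℕ → Polynomial F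
  | 0 => X
  | k + 1 => fIter d c k ^ d + C c

/-- `c₀` is a root of the Gleason polynomial `G_{d,n} = ∏_{k ∣ n} a_k^{μ(n/k)}`. -/
def isGleasonRoot (d n : ℕ) (c₀ : ℂ) : Prop :=
  ∃ g : Polynomial ℤ,
    g * ∏ k ∈ n.divisors, aPoly d k ^ ((-(ArithmeticFunction.moebius (n / k))).toNat)
        = ∏ k ∈ n.divisors, aPoly d k ^ ((ArithmeticFunction.moebius (n / k)).toNat)
    ∧ Polynomial.aeval c₀ g = 0

/-- `c₀` is a root of the Misiurewicz polynomial `G_{d,m,n}^ζ`. -/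
def isMisiurewiczRoot (d m n : ℕ) (ζ c₀ : ℂ) : Prop :=
  ∃ g : Polynomial ℂ,
    g * ((∏ k ∈ n.divisors,
            ((aPoly d (m + k - 1)).map (Int.castRingHom ℂ) -
              C ζ * (aPoly d (m - 1)).map (Int.castRingHom ℂ))
                ^ ((-(ArithmeticFunction.moebius (n / k))).toNat)) *
          (if n ∣ (m - 1) then
            ∏ k ∈ n.divisors, ((aPoly d k).map (Int.castRingHom ℂ))
                ^ ((ArithmeticFunction.moebius (n / k)).toNat)
          else 1))
        = (∏ k ∈ n.divisors,
            ((aPoly d (m + k - 1)).map (Int.castRingHom ℂ) -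
              C ζ * (aPoly d (m - 1)).map (Int.castRingHom ℂ))
                ^ ((ArithmeticFunction.moebius (n / k)).toNat)) *
          (if n ∣ (m - 1) then
            ∏ k ∈ n.divisors, ((aPoly d k).map (Int.castRingHom ℂ))
                ^ ((-(ArithmeticFunction.moebius (n / k))).toNat)
          else 1)
    ∧ g.eval c₀ = 0

/-- The polynomial `F_{k,i}^{(d,c₀)} = ∏_{j=1}^{d-1} (f_{d,c₀}^k - ζ^j a_i(c₀))` over `ℂ`. -/
def FPoly (d : ℕ) (c₀ ζ : ℂ) (k i : ℕ) : Polynomial ℂ :=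
  ∏ j ∈ Finset.Icc 1 (d - 1), (fIter d c₀ k - C (ζ ^ j * aSeq d c₀ i))

/-- Ring homomorphisms commute with the value sequence. -/
theorem map_aSeq (d : ℕ) {R S : Type*} [CommRing R] [CommRing S] (φ : R →+* S) (c : R) (k : ℕ) :
    φ (aSeq d c k) = aSeq d (φ c) k := by
  induction k with
  | zero => simp [aSeq]
  | succ k ih => simp [aSeq, ih]

/-- Ring homomorphisms commute with the iterates of `x ^ d + c`. -/
theorem map_fIter (d : ℕ) {R S : Type*} [CommRing R] [CommRing S] (φ : R →+* S) (c : R) (k : ℕ) :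
    (fIter d c k).map φ = fIter d (φ c) k := by
  induction k with
  | zero => simp [fIter]
  | succ k ih => simp [fIter, ih]

theorem aeval_aPoly (d : ℕ) {R : Type*} [CommRing R] (c : R) (k : ℕ) :
    aeval c (aPoly d k) = aSeq d c k := by
  induction k with
  | zero => simp [aPoly, aSeq]
  | succ k ih => simp [aPoly, aSeq, ih]

theorem aSeq_add_of_eq_zero (d : ℕ) {R : Type*} [CommRing R] (c : R) {m : ℕ}
    (hm : aSeq d c m = 0) (j : ℕ) : aSeq d c (m + j) = aSeq d c j := by
  induction j with
  | zero => simpa [aSeq] using hm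
  | succ j ih => rw [← add_assoc, aSeq, aSeq, ih]

theorem aSeq_mul_add_of_eq_zero (d : ℕ) {R : Type*} [CommRing R] (c : R) {m : ℕ}
    (hm : aSeq d c m = 0) (q j : ℕ) : aSeq d c (m * q + j) = aSeq d c j := by
  induction q with
  | zero => simp
  | succ q ih =>
    rw [show m * (q + 1) + j = m + (m * q + j) by ring, aSeq_add_of_eq_zero d c hm, ih]

theorem aPoly_succ_monic_natDegree {d : ℕ} (hd : 2 ≤ d) (k : ℕ) :
    (aPoly d (k + 1)).Monic ∧ (aPoly d (k + 1)).natDegree = d ^ k := by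
  induction k with
  | zero => simp [aPoly, show d ≠ 0 by omega]
  | succ k ih =>
    obtain ⟨hmon, hdeg⟩ := ih
    have hpow : (aPoly d (k + 1) ^ d).Monic := hmon.pow d
    have hpowdeg : (aPoly d (k + 1) ^ d).natDegree = d ^ (k + 1) := by
      rw [hmon.natDegree_pow, hdeg, pow_succ']
    have hlt : (X : ℤ[X]).natDegree < (aPoly d (k + 1) ^ d).natDegree := by
      rw [hpowdeg, natDegree_X]
      exact Nat.one_lt_pow k.succ_ne_zero (by omega)
    rw [aPoly]
    exact ⟨hpow.add_of_left (degree_lt_degree hlt),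
      (natDegree_add_eq_left_of_natDegree_lt hlt).trans hpowdeg⟩

/-- A root of the Gleason polynomial `G_{d,n}` satisfies `a_n(c₀) = 0`. -/
theorem isGleasonRoot.aSeq_eq_zero {d n : ℕ} {c₀ : ℂ} (h : isGleasonRoot d n c₀) :
    aSeq d c₀ n = 0 := by
  obtain ⟨g, hg, hroot⟩ := h
  have hprod := congrArg (aeval c₀) hg
  rw [map_mul, hroot, zero_mul, map_prod, eq_comm, Finset.prod_eq_zero_iff] at hprod
  obtain ⟨m, hmem, hm⟩ := hprod
  rw [map_pow, aeval_aPoly] at hm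
  obtain ⟨q, rfl⟩ := Nat.dvd_of_mem_divisors hmem
  simpa [aSeq] using aSeq_mul_add_of_eq_zero d c₀ (eq_zero_of_pow_eq_zero hm) q 0

/-- A parameter with `a_n(c) = 0` for some `n ≥ 1` is an algebraic integer. -/
theorem isIntegral_of_aSeq_eq_zero {d : ℕ} (hd : 2 ≤ d) {R : Type*} [CommRing R] {c : R} {n : ℕ}
    (hn : 1 ≤ n) (h : aSeq d c n = 0) : IsIntegral ℤ c := by
  obtain ⟨m, rfl⟩ := Nat.exists_eq_add_of_le' hn
  exact ⟨aPoly d (m + 1), (aPoly_succ_monic_natDegree hd m).1, by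
    rw [← aeval_def, aeval_aPoly, h]⟩

/-- For prime `d`, the iterates of `x ^ d + c` are congruent to `x ^ (d ^ k) + a_k(c)` modulo
`d * x ^ d`, over any commutative ring. -/
theorem exists_fIter_eq {d : ℕ} (hd : d.Prime) {R : Type*} [CommRing R] (c : R) (k : ℕ) :
    ∃ F : R[X], fIter d c (k + 1) =
      X ^ d ^ (k + 1) + C (d : R) * X ^ d * F + C (aSeq d c (k + 1)) := by
  induction k with
  | zero => exact ⟨0, by simp [fIter, aSeq, hd.ne_zero]⟩
  | succ k ih =>
    obtain ⟨F, hF⟩ := ih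
    obtain ⟨r, hr⟩ := exists_add_pow_prime_eq hd
      (X ^ d ^ (k + 1) + C (d : R) * X ^ d * F) (C (aSeq d c (k + 1)))
    obtain ⟨s, hs⟩ := exists_add_pow_prime_eq hd (X ^ d ^ (k + 1)) (C (d : R) * X ^ d * F)
    have hX : (X : R[X]) ^ d ^ (k + 1) = X ^ d * X ^ (d ^ (k + 1) - d) := by
      rw [← pow_add, Nat.add_sub_cancel' (Nat.le_self_pow k.succ_ne_zero d)]
    have hY : (C (d : R) * X ^ d * F) ^ d
        = C (d : R) * X ^ d * F * (C (d : R) * X ^ d * F) ^ (d - 1) := by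
      rw [mul_pow_sub_one hd.ne_zero]
    have hsucc : aSeq d c (k + 1 + 1) = aSeq d c (k + 1) ^ d + c := rfl
    have hC : (d : R[X]) = C (d : R) := by simp
    refine ⟨F * (C (d : R) * X ^ d * F) ^ (d - 1)
      + X ^ d ^ (k + 1) * (C (d : R) * F) * s
      + (X ^ (d ^ (k + 1) - d) + C (d : R) * F) * C (aSeq d c (k + 1)) * r, ?_⟩
    rw [fIter, hF, hr, hs, hY, hsucc, C_add, C_pow, hC, ← pow_mul, ← pow_succ]
    generalize (C (d : R) * X ^ d * F) ^ (d - 1) = Z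
    linear_combination (C (d : R) * C (aSeq d c (k + 1)) * r) * hX

/-- `exists_fIter_eq` transported along a ring homomorphism `φ` whose image contains the
parameter: the coefficients of `F` come from the source of `φ`. -/
theorem exists_fIter_map_eq {d : ℕ} (hd : d.Prime) {R S : Type*} [CommRing R] [CommRing S]
    (φ : R →+* S) (c : R) (k : ℕ) :
    ∃ F : R[X], fIter d (φ c) (k + 1) =
      X ^ d ^ (k + 1) + C (d : S) * X ^ d * F.map φ + C (aSeq d (φ c) (k + 1)) := by
  obtain ⟨F, hF⟩ := exists_fIter_eq hd c k
  refine ⟨F, ?_⟩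
  rw [← map_fIter, hF, ← map_aSeq]
  simp

set_option maxHeartbeats 1000000 in
set_option synthInstance.maxHeartbeats 400000 in
/-- If `c₀` is a Gleason parameter (root of `G_{d,n}`) and `K = ℚ(c₀)`
with ring of integers `O_K`, then for every `k ≥ 1` there is `F ∈ O_K[x]` with
`f_{d,c₀}^k(x) = x^{d^k} + d x^d F(x) + a_i(c₀)`, where `i` is the smallest positive integer
with `k ≡ i (mod n)`; in particular if `n ∣ k` then
`f_{d,c₀}^k(x) = x^{d^k} + d x^d F(x)` for some `F ∈ O_K[x]`. -/
theorem stmt12 (d : ℕ) (hd : Nat.Prime d) (k : ℕ) (hk : 1 ≤ k) (n : ℕ) (hn : 1 ≤ n)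
    (c₀ : ℂ) (hc₀ : isGleasonRoot d n c₀) :
    (∃ F : Polynomial (integralClosure ℤ ℚ⟮c₀⟯),
      fIter d (IntermediateField.AdjoinSimple.gen ℚ c₀) k =
        X ^ d ^ k
          + C ((d : ℕ) : ℚ⟮c₀⟯) * X ^ d
              * F.map (algebraMap (integralClosure ℤ ℚ⟮c₀⟯) ℚ⟮c₀⟯)
          + C (aSeq d (IntermediateField.AdjoinSimple.gen ℚ c₀)
              (if k % n = 0 then n else k % n)))
    ∧ (n ∣ k → ∃ F : Polynomial (integralClosure ℤ ℚ⟮c₀⟯),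
        fIter d (IntermediateField.AdjoinSimple.gen ℚ c₀) k =
          X ^ d ^ k
            + C ((d : ℕ) : ℚ⟮c₀⟯) * X ^ d
                * F.map (algebraMap (integralClosure ℤ ℚ⟮c₀⟯) ℚ⟮c₀⟯)) := by
  set K := ℚ⟮c₀⟯
  set γ : K := IntermediateField.AdjoinSimple.gen ℚ c₀ with hγ
  have hzero : aSeq d γ n = 0 := by
    apply (algebraMap K ℂ).injective
    rw [map_aSeq, map_zero, hγ, IntermediateField.AdjoinSimple.algebraMap_gen]
    exact hc₀.aSeq_eq_zero
  have hint : IsIntegral ℤ γ := isIntegral_of_aSeq_eq_zero hd.two_le hn hzero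
  have hindex : aSeq d γ (if k % n = 0 then n else k % n) = aSeq d γ k := by
    have hmod : aSeq d γ k = aSeq d γ (k % n) := by
      conv_lhs => rw [← Nat.div_add_mod k n]
      exact aSeq_mul_add_of_eq_zero d γ hzero _ _
    split_ifs with h
    · rw [hmod, h, hzero, aSeq]
    · exact hmod.symm
  obtain ⟨m, rfl⟩ := Nat.exists_eq_add_of_le' hk
  obtain ⟨F, hF⟩ : ∃ F : (integralClosure ℤ K)[X], fIter d γ (m + 1) =
      X ^ d ^ (m + 1) + C (d : K) * X ^ d * F.map (algebraMap (integralClosure ℤ K) K)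
        + C (aSeq d γ (m + 1)) :=
    exists_fIter_map_eq hd (algebraMap (integralClosure ℤ K) K)
      ⟨γ, (mem_integralClosure_iff ℤ K).mpr hint⟩ m
  refine ⟨⟨F, by rw [hindex, hF]⟩, fun hdvd => ⟨F, ?_⟩⟩
  rw [← hindex, if_pos (Nat.mod_eq_zero_of_dvd hdvd), hzero, C_0, add_zero] at hF
  exact hF
end
end

section
/- Let d be a prime and let c_0 ∈ ℂ be a root of the Gleason polynomial G_{d,n} for some n ≥ 1. Set K = ℚ(c_0) ⊂ ℂ. Then for any primitive d-th root of unity ζ, the intersection of fields K ∩ ℚ(ζ) = ℚ. -/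
open Polynomial IntermediateField

noncomputable section

/-- For `i ≥ 1` the polynomial `a_i` is monic and non-constant. -/
theorem aPoly_succ_monic {d : ℕ} (hd : 2 ≤ d) (i : ℕ) :
    (aPoly d (i + 1)).Monic ∧ 1 ≤ (aPoly d (i + 1)).natDegree := by
  induction i with
  | zero => simp [aPoly, zero_pow (by omega : d ≠ 0)]
  | succ i ih =>
    obtain ⟨hm, hdeg⟩ := ih
    have hp : (aPoly d (i + 1) ^ d).Monic := hm.pow d
    have hn : 2 ≤ (aPoly d (i + 1) ^ d).natDegree := by
      rw [hm.natDegree_pow]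
      nlinarith
    have hlt : (X : ℤ[X]).natDegree < (aPoly d (i + 1) ^ d).natDegree := by
      rw [natDegree_X]
      omega
    refine ⟨hp.add_of_left (degree_lt_degree hlt), ?_⟩
    change 1 ≤ (aPoly d (i + 1) ^ d + X).natDegree
    rw [natDegree_add_eq_left_of_natDegree_lt hlt]
    omega

/-- The derivative of `a_i` is congruent to `1` modulo `d`. -/
theorem exists_derivative_aPoly_succ (d i : ℕ) :
    ∃ h : ℤ[X], derivative (aPoly d (i + 1)) = 1 + (d : ℤ[X]) * h := by
  refine ⟨aPoly d i ^ (d - 1) * derivative (aPoly d i), ?_⟩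
  simp only [aPoly, derivative_add, derivative_pow, derivative_X, map_natCast]
  ring

/-- A Gleason parameter is a root of some `a_i` with `i ≥ 1`. -/
theorem isGleasonRoot.exists_aeval_aPoly_eq_zero {d n : ℕ} {c₀ : ℂ} (h : isGleasonRoot d n c₀) :
    ∃ i, aeval c₀ (aPoly d (i + 1)) = 0 := by
  obtain ⟨g, hg, h0⟩ := h
  have hprod := congrArg (aeval c₀) hg
  rw [map_mul, h0, zero_mul, map_prod, eq_comm, Finset.prod_eq_zero_iff] at hprod
  obtain ⟨k, hk, hk0⟩ := hprod
  rw [map_pow] at hk0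
  obtain ⟨i, rfl⟩ := Nat.exists_eq_succ_of_ne_zero (Nat.pos_of_mem_divisors hk).ne'
  exact ⟨i, eq_zero_of_pow_eq_zero hk0⟩

/-- An ideal of a ring of integers containing an element congruent to `1` modulo a prime `p`
has norm prime to `p`. -/
theorem not_dvd_absNorm_of_one_add_mul_mem {K : Type*} [Field K] [NumberField K] {p : ℕ}
    (hp : p.Prime) {I : Ideal (NumberField.RingOfIntegers K)} (hI : I ≠ ⊥)
    {h : NumberField.RingOfIntegers K} (hmem : 1 + p * h ∈ I) : ¬ p ∣ I.absNorm := by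
  intro hdvd
  have := Fact.mk hp
  have : Finite (NumberField.RingOfIntegers K ⧸ I) := Ideal.finiteQuotientOfFreeOfNeBot I hI
  rw [Ideal.absNorm_apply] at hdvd
  change p ∣ Nat.card (NumberField.RingOfIntegers K ⧸ I) at hdvd
  obtain ⟨x, hx⟩ := exists_prime_addOrderOf_dvd_card' p hdvd
  have hpx : (p : NumberField.RingOfIntegers K ⧸ I) * x = 0 := by
    rw [← nsmul_eq_mul, ← hx, addOrderOf_nsmul_eq_zero]
  have hu := Ideal.Quotient.eq_zero_iff_mem.mpr hmem
  rw [map_add, map_one, map_mul, map_natCast] at hu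
  have hx0 : x = 0 := by
    linear_combination x * hu - Ideal.Quotient.mk I h * hpx
  rw [hx0, addOrderOf_zero] at hx
  exact hp.one_lt.ne hx

/-- If an integral generator of `K` is a root of a polynomial over `ℤ` whose derivative is
congruent to `1` modulo a prime `p`, then `p` does not divide the discriminant of `K`. -/
theorem not_dvd_discr_of_derivative_eq {K : Type*} [Field K] [NumberField K] {p : ℕ}
    (hp : p.Prime) {f h : ℤ[X]} (hf : derivative f = 1 + (p : ℤ[X]) * h)
    {x : NumberField.RingOfIntegers K} (hx : Algebra.adjoin ℚ {(x : K)} = ⊤)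
    (hroot : aeval x f = 0) : ¬ (p : ℤ) ∣ NumberField.discr K := by
  obtain ⟨q, hq⟩ :=
    minpoly.isIntegrallyClosed_dvd (R := ℤ) (NumberField.RingOfIntegers.isIntegral x) hroot
  have hmem := aeval_derivative_mem_differentIdeal ℤ ℚ K x hx
  have hder : aeval x (derivative f) = aeval x (derivative (minpoly ℤ x)) * aeval x q := by
    rw [hq, derivative_mul, map_add, map_mul, map_mul, minpoly.aeval, zero_mul, add_zero]
  have hmem' : 1 + (p : NumberField.RingOfIntegers K) * aeval x h ∈
      differentIdeal ℤ (NumberField.RingOfIntegers K) := by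
    rw [hf, map_add, map_one, map_mul, map_natCast] at hder
    rw [hder]
    exact Ideal.mul_mem_right _ _ hmem
  have := not_dvd_absNorm_of_one_add_mul_mem hp differentIdeal_ne_bot hmem'
  rwa [NumberField.absNorm_differentIdeal K, ← Int.natCast_dvd] at this

/-- Number fields with coprime discriminants intersect in `ℚ`. -/
theorem inf_eq_bot_of_isCoprime_discr {L : Type*} [Field L] [CharZero L]
    (K₁ K₂ : IntermediateField ℚ L) [NumberField K₁] [NumberField K₂]
    (h : IsCoprime (NumberField.discr K₁) (NumberField.discr K₂)) : K₁ ⊓ K₂ = ⊥ := by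
  let := (inclusion (inf_le_left : K₁ ⊓ K₂ ≤ K₁)).toRingHom.toAlgebra
  let := (inclusion (inf_le_right : K₁ ⊓ K₂ ≤ K₂)).toRingHom.toAlgebra
  have : NumberField ↥(K₁ ⊓ K₂) := NumberField.of_tower ℚ K₁ ↥(K₁ ⊓ K₂)
  have hunit : IsUnit (NumberField.discr ↥(K₁ ⊓ K₂)) :=
    h.isUnit_of_dvd' (NumberField.discr_dvd_discr _ _) (NumberField.discr_dvd_discr _ _)
  contrapose! hunit
  have : 1 < Module.finrank ℚ ↥(K₁ ⊓ K₂) := by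
    refine Nat.one_lt_iff_ne_zero_and_ne_one.mpr ⟨Module.finrank_pos.ne', ?_⟩
    rwa [ne_eq, ← IntermediateField.finrank_eq_one_iff] at hunit
  exact Int.isUnit_iff_abs_eq.not.mpr <| by linarith [NumberField.abs_discr_gt_two this]

/-- If `c₀` is a Gleason parameter (root of `G_{d,n}`), then for any
primitive `d`-th root of unity `ζ`, the subfields `K = ℚ(c₀)` and `ℚ(ζ)` of `ℂ` intersect
in `ℚ`. -/
theorem stmt13 (d : ℕ) (hd : Nat.Prime d) (n : ℕ) (hn : 1 ≤ n)
    (c₀ : ℂ) (hc₀ : isGleasonRoot d n c₀)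
    (ζ : ℂ) (hζ : IsPrimitiveRoot ζ d) :
    ℚ⟮c₀⟯ ⊓ ℚ⟮ζ⟯ = (⊥ : IntermediateField ℚ ℂ) := by
  obtain ⟨i, hi⟩ := hc₀.exists_aeval_aPoly_eq_zero
  obtain ⟨h, hder⟩ := exists_derivative_aPoly_succ d i
  have hint : IsIntegral ℤ c₀ := ⟨aPoly d (i + 1), (aPoly_succ_monic hd.two_le i).1, hi⟩
  have : Fact d.Prime := ⟨hd⟩
  have : NumberField ℚ⟮c₀⟯ :=
    { to_finiteDimensional := adjoin.finiteDimensional hint.tower_top }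
  have hζint : IsIntegral ℚ ζ := (hζ.isIntegral hd.pos).tower_top
  have : NumberField ℚ⟮ζ⟯ :=
    { to_finiteDimensional := adjoin.finiteDimensional hζint }
  have : IsCyclotomicExtension {d} ℚ ℚ⟮ζ⟯ := by
    change IsCyclotomicExtension {d} ℚ ℚ⟮ζ⟯.toSubalgebra
    rw [adjoin_simple_toSubalgebra_of_isAlgebraic hζint.isAlgebraic]
    exact hζ.adjoin_isCyclotomicExtension ℚ
  have hgen : IsIntegral ℤ (AdjoinSimple.gen ℚ c₀) := by
    rwa [← isIntegral_algebraMap_iff (algebraMap ℚ⟮c₀⟯ ℂ).injective, AdjoinSimple.algebraMap_gen]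
  let x : NumberField.RingOfIntegers ℚ⟮c₀⟯ := ⟨AdjoinSimple.gen ℚ c₀, hgen⟩
  have hx : Algebra.adjoin ℚ {(x : ℚ⟮c₀⟯)} = ⊤ := by
    have htop := (adjoin.powerBasis (hint.tower_top (A := ℚ))).adjoin_gen_eq_top
    rw [adjoin.powerBasis_gen] at htop
    exact htop
  have hroot : aeval x (aPoly d (i + 1)) = 0 := by
    have hinj : Function.Injective (algebraMap (NumberField.RingOfIntegers ℚ⟮c₀⟯) ℂ) :=
      FaithfulSMul.algebraMap_injective _ _
    apply hinj
    rw [map_zero, ← aeval_algebraMap_apply]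
    exact hi
  have hndvd := not_dvd_discr_of_derivative_eq hd hder hx hroot
  apply inf_eq_bot_of_isCoprime_discr
  rw [IsCyclotomicExtension.Rat.discr_prime d ℚ⟮ζ⟯]
  have hcop : IsCoprime (NumberField.discr ℚ⟮c₀⟯) (d : ℤ) :=
    ((Nat.prime_iff_prime_int.mp hd).coprime_iff_not_dvd.mpr hndvd).symm
  exact (isCoprime_one_right.neg_right.pow_right).mul_right hcop.pow_right
end
end

section
/- Let K be a field, let f ∈ K[x] be a non-constant polynomial, and let α ∈ K. If f^i − α is irreducible over K for infinitely many positive integers i, then f^i − α is irreducible over K for all i ≥ 1. -/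
open Polynomial

noncomputable section

/-- Iterates of a polynomial under composition: `f^0 = x`, `f^{i+1} = f ∘ f^i`. -/
def iterComp {K : Type*} [CommRing K] (f : Polynomial K) : ℕ → Polynomial K
  | 0 => X
  | i + 1 => f.comp (iterComp f i)

theorem iterComp_add {K : Type*} [CommRing K] (f : Polynomial K) (m n : ℕ) :
    iterComp f (m + n) = (iterComp f m).comp (iterComp f n) := by
  induction m with
  | zero => simp [iterComp]
  | succ m ih => rw [Nat.add_right_comm, iterComp, iterComp, ih, comp_assoc]

theorem natDegree_iterComp {K : Type*} [CommRing K] [NoZeroDivisors K] [Nontrivial K]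
    (f : Polynomial K) (n : ℕ) : (iterComp f n).natDegree = f.natDegree ^ n := by
  induction n with
  | zero => simp [iterComp]
  | succ n ih => rw [iterComp, natDegree_comp, ih, pow_succ']

theorem irreducible_of_irreducible_comp {K : Type*} [Field K] {p q : Polynomial K}
    (hq : 0 < q.natDegree) (h : Irreducible (p.comp q)) : Irreducible p := by
  have isUnit_of_comp {r : Polynomial K} (hr : IsUnit (r.comp q)) : IsUnit r := by
    have hdeg := natDegree_eq_zero_of_isUnit hr
    rw [natDegree_comp, Nat.mul_eq_zero, or_iff_left hq.ne'] at hdeg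
    rw [eq_C_of_natDegree_eq_zero hdeg] at hr ⊢
    rwa [C_comp] at hr
  refine ⟨fun hp => h.not_isUnit (hp.map (compRingHom q)), fun a b hab => ?_⟩
  rw [hab, mul_comp] at h
  exact (h.isUnit_or_isUnit rfl).imp isUnit_of_comp isUnit_of_comp

/-- If `f` is a non-constant polynomial over a field `K`, `α ∈ K`, and
`f^i - α` is irreducible over `K` for infinitely many positive integers `i`, then `f^i - α`
is irreducible over `K` for all `i ≥ 1`. -/
theorem stmt15 {K : Type*} [Field K] (f : Polynomial K) (hf : 0 < f.natDegree) (α : K)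
    (h : {i : ℕ | 0 < i ∧ Irreducible (iterComp f i - C α)}.Infinite) :
    ∀ i : ℕ, 1 ≤ i → Irreducible (iterComp f i - C α) := by
  intro i _
  obtain ⟨n, ⟨_, hn⟩, hin⟩ := h.exists_gt i
  refine irreducible_of_irreducible_comp (q := iterComp f (n - i)) ?_ ?_
  · rw [natDegree_iterComp]
    exact pow_pos hf _
  · rwa [sub_comp, C_comp, ← iterComp_add, Nat.add_sub_cancel' hin.le]
end
end

section
/- Let n > 1 be an odd positive integer, and let G be an abelian subgroup of the symmetric group S_n that acts transitively on {1, …, n}. Then G is contained in the alternating group A_n. -/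
/-- A transitive abelian permutation group acts regularly, so its order is the degree. -/
theorem Subgroup.natCard_eq_of_comm_of_transitive {α : Type*} [Nonempty α]
    (G : Subgroup (Equiv.Perm α))
    (hab : ∀ a ∈ G, ∀ b ∈ G, a * b = b * a)
    (htrans : ∀ i j : α, ∃ σ ∈ G, σ i = j) :
    Nat.card G = Nat.card α := by
  obtain ⟨x⟩ := ‹Nonempty α›
  refine Nat.card_eq_of_bijective (fun g : G => (g : Equiv.Perm α) x) ⟨?_, ?_⟩
  · rintro ⟨g, hg⟩ ⟨h, hh⟩ hgh
    refine Subtype.ext (Equiv.ext fun j => ?_)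
    obtain ⟨k, hk, rfl⟩ := htrans x j
    calc g (k x) = k (g x) := Equiv.congr_fun (hab g hg k hk) x
      _ = k (h x) := congrArg k hgh
      _ = h (k x) := Equiv.congr_fun (hab k hk h hh) x
  · intro j
    obtain ⟨k, hk, hkj⟩ := htrans x j
    exact ⟨⟨k, hk⟩, hkj⟩

/-- Every permutation group of odd order consists of even permutations. -/
theorem Subgroup.le_alternatingGroup_of_odd_natCard {α : Type*} [Fintype α] [DecidableEq α]
    (G : Subgroup (Equiv.Perm α)) (hG : Odd (Nat.card G)) :
    G ≤ alternatingGroup α := by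
  intro σ hσ
  have hpow : σ ^ Nat.card G = 1 :=
    congrArg Subtype.val (pow_card_eq_one' (x := (⟨σ, hσ⟩ : G)))
  have hsign : Equiv.Perm.sign σ ^ Nat.card G = 1 := by rw [← map_pow, hpow, map_one]
  rw [Equiv.Perm.mem_alternatingGroup]
  rcases Int.units_eq_one_or (Equiv.Perm.sign σ) with h | h
  · exact h
  · rw [h, hG.neg_one_pow] at hsign
    exact h.trans hsign

/-- Let `n > 1` be odd and let `G` be an abelian subgroup of `S_n` acting
transitively on `{1, …, n}`. Then `G` is contained in the alternating group `A_n`. -/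
theorem stmt18 (n : ℕ) (hn : 1 < n) (hodd : Odd n)
    (G : Subgroup (Equiv.Perm (Fin n)))
    (hab : ∀ a ∈ G, ∀ b ∈ G, a * b = b * a)
    (htrans : ∀ i j : Fin n, ∃ σ ∈ G, σ i = j) :
    G ≤ alternatingGroup (Fin n) := by
  have : Nonempty (Fin n) := ⟨⟨0, by omega⟩⟩
  refine G.le_alternatingGroup_of_odd_natCard ?_
  rwa [G.natCard_eq_of_comm_of_transitive hab htrans, Nat.card_fin]
end
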